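/- arXiv:2401.10821 — 2 statements merged into one kernel-verified Lean document; each statement's English description precedes it below -/
import Mathlib

section
/- Let n, D be positive integers with gcd(n, D) = 1 and D squarefree. Then any integer distance set contained in the circle of radius n/(2√D) centered at the origin has size at most O(τ(n²)) ≪ n^{O(1/log log n)}, where τ is the divisor function. More precisely, writing n = n₁n₂ where n₁ collects the primes p ∣ n with (-D/p) = -1 and n₂ collects those with (-D/p) = 1, the size is at most the number of integer solutions (x,y) of x² + D y² = n₂². -/
theorem dvd_of_sq_add_mul_sq_eq_of_legendreSym_eq_neg_one {D : ℕ} (hD : 0 < D) (n₁ : ℕ)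
    (h : ∀ p : ℕ, (hp : p.Prime) → p ∣ n₁ → @legendreSym p ⟨hp⟩ (-(D : ℤ)) = -1) :
    ∀ {m x y : ℤ}, x ^ 2 + (D : ℤ) * y ^ 2 = ((n₁ : ℤ) * m) ^ 2 →
      (n₁ : ℤ) ∣ x ∧ (n₁ : ℤ) ∣ y := by
  induction n₁ using induction_on_primes with
  | zero =>
    intro m x y e
    have hD' : (0 : ℤ) < D := by exact_mod_cast hD
    have hx : x ^ 2 = 0 := by
      have := mul_nonneg hD'.le (sq_nonneg y)
      have := sq_nonneg x
      push_cast at e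
      nlinarith
    have hy : (D : ℤ) * y ^ 2 = 0 := by
      push_cast at e
      nlinarith
    simp_all [hD.ne']
  | one => intros; simp
  | prime_mul p a hp ih =>
    intro m x y e
    have : Fact p.Prime := ⟨hp⟩
    have hp0 : (p : ℤ) ≠ 0 := by exact_mod_cast hp.ne_zero
    obtain ⟨⟨x', rfl⟩, ⟨y', rfl⟩⟩ :=
      legendreSym.prime_dvd_of_eq_neg_one (h p hp (dvd_mul_right _ _)) (x := x) (y := y)
        ⟨p * (a * m) ^ 2, by push_cast at e; linear_combination e⟩
    have e' : x' ^ 2 + (D : ℤ) * y' ^ 2 = ((a : ℤ) * m) ^ 2 := by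
      apply mul_left_cancel₀ (pow_ne_zero 2 hp0)
      push_cast at e
      linear_combination e
    obtain ⟨h1, h2⟩ := ih (fun q hq hqa => h q hq (hqa.mul_left p)) e'
    push_cast
    exact ⟨mul_dvd_mul_left _ h1, mul_dvd_mul_left _ h2⟩

/-- Two primitive representations `(x, y)`, `(x', y')` of `M` by `X² + D Y²` that have the same
greatest common divisor with `M` relative to a third one have nearly proportional vectors. -/
theorem dvd_two_mul_cross_of_gcd_eq {D M x₀ y₀ x y x' y' : ℤ} (hDM : IsCoprime M D)
    (h₀ : x₀ ^ 2 + D * y₀ ^ 2 = M) (h : x ^ 2 + D * y ^ 2 = M) (h' : x' ^ 2 + D * y' ^ 2 = M)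
    (c₀ : IsCoprime x₀ y₀) (c : IsCoprime x y)
    (e : Int.gcd M (x * y₀ - x₀ * y) = Int.gcd M (x' * y₀ - x₀ * y')) (hM : M ≠ 0) :
    M ∣ 2 * (x * y' - x' * y) := by
  have cop_y₀ : IsCoprime M y₀ := by
    rw [← h₀]
    have := (c₀.pow_left (m := 2)).add_mul_right_left (D * y₀)
    rwa [show x₀ ^ 2 + D * y₀ * y₀ = x₀ ^ 2 + D * y₀ ^ 2 by ring] at this
  have cop_x : IsCoprime M x := by
    have h1 : IsCoprime x (D * y ^ 2) := by
      refine IsCoprime.mul_right ?_ c.pow_right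
      have : IsCoprime (x ^ 2 + D * y ^ 2) D := by rwa [h]
      have : IsCoprime (x ^ 2) D := by
        have := this.add_mul_left_left (-(y ^ 2))
        rwa [show x ^ 2 + D * y ^ 2 + D * -(y ^ 2) = x ^ 2 by ring] at this
      exact (IsCoprime.pow_left_iff (by norm_num)).1 this
    rw [← h]
    have := h1.symm.add_mul_right_left x
    rwa [show D * y ^ 2 + x * x = x ^ 2 + D * y ^ 2 by ring] at this
  have key : ∀ {u v : ℤ}, u ^ 2 + D * v ^ 2 = M →
      ∀ g h : ℤ, g = (Int.gcd M (u * y₀ - x₀ * v) : ℤ) → g * h = M → h ∣ u * y₀ + x₀ * v := by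
    intro u v huv g h hg hgh
    have hg0 : g ≠ 0 := by rintro rfl; simp at hgh; exact hM hgh.symm
    obtain ⟨a, ha⟩ : g ∣ u * y₀ - x₀ * v := hg ▸ Int.gcd_dvd_right _ _
    have hcop : IsCoprime h a := by
      obtain ⟨s, t, hst⟩ : ∃ s t : ℤ, g = M * s + (u * y₀ - x₀ * v) * t :=
        ⟨_, _, hg.trans (Int.gcd_eq_gcd_ab _ _)⟩
      refine ⟨s, t, mul_left_cancel₀ hg0 ?_⟩
      rw [ha, ← hgh] at hst
      linear_combination -hst
    refine hcop.dvd_of_dvd_mul_left (?_ : h ∣ a * _)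
    refine ⟨y₀ ^ 2 - v ^ 2, mul_left_cancel₀ hg0 ?_⟩
    have : (u * y₀ - x₀ * v) * (u * y₀ + x₀ * v) = M * (y₀ ^ 2 - v ^ 2) := by
      linear_combination y₀ ^ 2 * huv - v ^ 2 * h₀
    rw [ha, ← hgh] at this
    linear_combination this
  obtain ⟨k, hk⟩ : (Int.gcd M (x * y₀ - x₀ * y) : ℤ) ∣ M := Int.gcd_dvd_left _ _
  set g : ℤ := (Int.gcd M (x * y₀ - x₀ * y) : ℤ) with hg
  have hg' : g = (Int.gcd M (x' * y₀ - x₀ * y') : ℤ) := by rw [hg, e]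
  have gA : g ∣ x * y₀ - x₀ * y := Int.gcd_dvd_right _ _
  have gA' : g ∣ x' * y₀ - x₀ * y' := hg' ▸ Int.gcd_dvd_right _ _
  have kB := key h g k hg hk.symm
  have kB' := key h' g k hg' hk.symm
  have cgy : IsCoprime g y₀ := cop_y₀.of_isCoprime_of_dvd_left ⟨k, hk⟩
  have cky : IsCoprime k y₀ := cop_y₀.of_isCoprime_of_dvd_left ⟨g, by rw [hk]; ring⟩
  have ckx : IsCoprime k x := cop_x.of_isCoprime_of_dvd_left ⟨g, by rw [hk]; ring⟩
  have gC : g ∣ x * y' - x' * y := by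
    refine cgy.dvd_of_dvd_mul_left ?_
    have := dvd_sub (gA.mul_left y') (gA'.mul_left y)
    convert this using 1; ring
  have kC : k ∣ x * y' - x' * y := by
    refine cky.dvd_of_dvd_mul_left ?_
    have := dvd_sub (kB.mul_left y') (kB'.mul_left y)
    convert this using 1; ring
  obtain ⟨s, t, hst⟩ : ∃ s t : ℤ, 2 = g * s + k * t := by
    have hd : (Int.gcd g k : ℤ) ∣ 2 := by
      have d1 : (Int.gcd g k : ℤ) ∣ g := Int.gcd_dvd_left _ _
      have d2 : (Int.gcd g k : ℤ) ∣ k := Int.gcd_dvd_right _ _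
      refine (IsCoprime.mul_right (ckx.of_isCoprime_of_dvd_left d2)
        (cky.of_isCoprime_of_dvd_left d2)).dvd_of_dvd_mul_right ?_
      have := dvd_add (d1.trans gA) (d2.trans kB)
      convert this using 1; ring
    obtain ⟨r, hr⟩ := hd
    exact ⟨Int.gcdA g k * r, Int.gcdB g k * r, by
      rw [hr, Int.gcd_eq_gcd_ab]; ring⟩
  obtain ⟨a, ha⟩ := gC
  obtain ⟨b, hb⟩ := kC
  refine ⟨s * b + t * a, ?_⟩
  rw [hst, hk]
  linear_combination g * s * hb + k * t * ha

theorem card_primitive_le {D M : ℕ} (hD : 0 < D) (hM : 0 < M) (hDM : Nat.Coprime M D)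
    (T : Finset (ℤ × ℤ))
    (hT : ∀ v ∈ T, v.1 ^ 2 + (D : ℤ) * v.2 ^ 2 = M ∧ IsCoprime v.1 v.2) :
    T.card ≤ 25 * M.divisors.card := by
  obtain rfl | ⟨v₀, hv₀⟩ := T.eq_empty_or_nonempty
  · simp
  have hM0 : (M : ℤ) ≠ 0 := by exact_mod_cast hM.ne'
  have hD1 : (1 : ℤ) ≤ D := by exact_mod_cast hD
  set f : ℤ × ℤ → ℕ := fun v => Int.gcd M (v.1 * v₀.2 - v₀.1 * v.2) with hf
  have himg : T.image f ⊆ M.divisors := by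
    intro g hg
    obtain ⟨v, -, rfl⟩ := Finset.mem_image.1 hg
    refine Nat.mem_divisors.2 ⟨?_, hM.ne'⟩
    exact_mod_cast (Int.gcd_dvd_left (M : ℤ) (v.1 * v₀.2 - v₀.1 * v.2))
  refine (Finset.card_le_mul_card_image T 25 ?_).trans
    (Nat.mul_le_mul_left _ (Finset.card_le_card himg))
  intro g hg
  obtain ⟨v, hv, rfl⟩ := Finset.mem_image.1 hg
  obtain ⟨ev, cv⟩ := hT v hv
  have key : ∀ w ∈ T.filter (fun w => f w = f v), ∃ p q : ℤ,
      2 * (v.1 * w.1 + D * (v.2 * w.2)) = M * p ∧ 2 * (v.1 * w.2 - w.1 * v.2) = M * q ∧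
      p ^ 2 + D * q ^ 2 = 4 := by
    intro w hw
    rw [Finset.mem_filter] at hw
    obtain ⟨ew, cw⟩ := hT w hw.1
    obtain ⟨e₀, c₀⟩ := hT v₀ hv₀
    obtain ⟨q, hq⟩ := dvd_two_mul_cross_of_gcd_eq (Nat.isCoprime_iff_coprime.2 hDM) e₀ ev ew c₀ cv
      hw.2.symm hM0
    have hE : (2 * (v.1 * w.1 + D * (v.2 * w.2))) ^ 2
        + D * (2 * (v.1 * w.2 - w.1 * v.2)) ^ 2 = 4 * (M : ℤ) ^ 2 := by
      linear_combination 4 * (w.1 ^ 2 + D * w.2 ^ 2) * ev + 4 * M * ew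
    obtain ⟨p, hp⟩ : (M : ℤ) ∣ 2 * (v.1 * w.1 + D * (v.2 * w.2)) := by
      rw [← Int.pow_dvd_pow_iff (n := 2) (by norm_num)]
      rw [hq] at hE
      exact ⟨4 - D * q ^ 2, by linear_combination hE⟩
    refine ⟨p, q, hp, hq, ?_⟩
    rw [hp, hq] at hE
    apply mul_left_cancel₀ (pow_ne_zero 2 hM0)
    linear_combination hE
  choose! p q hpq using key
  have : (Finset.Icc (-2 : ℤ) 2 ×ˢ Finset.Icc (-2 : ℤ) 2).card = 25 := by decide
  rw [← this]
  refine Finset.card_le_card_of_injOn (fun w => (p w, q w)) ?_ ?_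
  · intro w hw
    obtain ⟨-, -, h⟩ := hpq w hw
    have hq : (q w) ^ 2 ≤ D * (q w) ^ 2 := le_mul_of_one_le_left (sq_nonneg _) hD1
    have hq0 := sq_nonneg (q w)
    have hp0 := sq_nonneg (p w)
    simp only [Finset.coe_product, Set.mem_prod, Finset.coe_Icc, Set.mem_Icc]
    refine ⟨⟨?_, ?_⟩, ?_, ?_⟩ <;> nlinarith
  · intro w hw w' hw' heq
    obtain ⟨h1, h2, -⟩ := hpq w hw
    obtain ⟨h1', h2', -⟩ := hpq w' hw'
    simp only [Prod.mk.injEq] at heq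
    rw [← heq.1] at h1'
    rw [← heq.2] at h2'
    have h2M : (2 * M : ℤ) ≠ 0 := mul_ne_zero two_ne_zero hM0
    ext
    · apply mul_left_cancel₀ h2M
      linear_combination v.1 * (h1 - h1') - D * v.2 * (h2 - h2') - 2 * (w.1 - w'.1) * ev
    · apply mul_left_cancel₀ h2M
      linear_combination v.2 * (h1 - h1') + v.1 * (h2 - h2') - 2 * (w.2 - w'.2) * ev

theorem card_sq_add_mul_sq_eq_sq_le {D n : ℕ} (hD : 0 < D) (hn : 0 < n) (hnD : Nat.Coprime n D)
    (T : Finset (ℤ × ℤ)) (hT : ∀ v ∈ T, v.1 ^ 2 + (D : ℤ) * v.2 ^ 2 = (n : ℤ) ^ 2) :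
    T.card ≤ 25 * n.divisors.card ^ 3 := by
  have hn0 : (n : ℤ) ≠ 0 := by exact_mod_cast hn.ne'
  have hgcd : ∀ v ∈ T, Int.gcd v.1 v.2 ∣ n := by
    intro v hv
    have h1 : (Int.gcd v.1 v.2 : ℤ) ∣ v.1 := Int.gcd_dvd_left _ _
    have h2 : (Int.gcd v.1 v.2 : ℤ) ∣ v.2 := Int.gcd_dvd_right _ _
    have h3 : (Int.gcd v.1 v.2 : ℤ) ^ 2 ∣ (n : ℤ) ^ 2 := by
      rw [← hT v hv]
      exact dvd_add (pow_dvd_pow_of_dvd h1 2) ((pow_dvd_pow_of_dvd h2 2).mul_left _)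
    exact_mod_cast (Int.pow_dvd_pow_iff (n := 2) (by norm_num)).1 h3
  have himg : T.image (fun v => Int.gcd v.1 v.2) ⊆ n.divisors := by
    intro g hg
    obtain ⟨v, hv, rfl⟩ := Finset.mem_image.1 hg
    exact Nat.mem_divisors.2 ⟨hgcd v hv, hn.ne'⟩
  have hsq : (n * n).divisors.card ≤ n.divisors.card * n.divisors.card := by
    rw [Nat.divisors_mul]
    exact Finset.card_mul_le
  refine (Finset.card_le_mul_card_image (f := fun v => Int.gcd v.1 v.2) T (25 * n.divisors.card ^ 2) ?_).trans ?_
  · intro g hg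
    obtain ⟨v, hv, rfl⟩ := Finset.mem_image.1 hg
    obtain ⟨m, hm⟩ := hgcd v hv
    set g := Int.gcd v.1 v.2
    have hg0 : 0 < g := Nat.pos_of_ne_zero (by rintro h; simp [h] at hm; omega)
    have hm0 : 0 < m := Nat.pos_of_ne_zero (by rintro rfl; simp at hm; omega)
    have hgz : (g : ℤ) ≠ 0 := by exact_mod_cast hg0.ne'
    have hmn : m ∣ n := ⟨g, by rw [hm, mul_comm]⟩
    have hmD : Nat.Coprime (m * m) D :=
      Nat.Coprime.mul_left (hnD.coprime_dvd_left hmn) (hnD.coprime_dvd_left hmn)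
    set F := T.filter (fun w => Int.gcd w.1 w.2 = g)
    have hF : ∀ w ∈ F, ∃ x y : ℤ, w.1 = g * x ∧ w.2 = g * y ∧ IsCoprime x y := by
      intro w hw
      have hwg : Int.gcd w.1 w.2 = g := (Finset.mem_filter.1 hw).2
      obtain ⟨x, y, hc, h1, h2⟩ := Int.exists_gcd_one (m := w.1) (n := w.2) (hwg ▸ hg0)
      rw [hwg] at h1 h2
      exact ⟨x, y, by rw [h1, mul_comm], by rw [h2, mul_comm], Int.isCoprime_iff_gcd_eq_one.2 hc⟩
    choose! X Y hXY using hF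
    have hinj : Set.InjOn (fun w => (X w, Y w)) F := by
      intro w hw w' hw' h
      simp only [Prod.mk.injEq] at h
      obtain ⟨h1, h2, -⟩ := hXY w hw
      obtain ⟨h1', h2', -⟩ := hXY w' hw'
      ext
      · rw [h1, h1', h.1]
      · rw [h2, h2', h.2]
    rw [← Finset.card_image_of_injOn hinj]
    refine (card_primitive_le hD (Nat.mul_pos hm0 hm0) hmD _ ?_).trans ?_
    · intro u hu
      obtain ⟨w, hw, rfl⟩ := Finset.mem_image.1 hu
      obtain ⟨h1, h2, h3⟩ := hXY w hw
      refine ⟨?_, h3⟩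
      have := hT w (Finset.mem_filter.1 hw).1
      rw [h1, h2, hm] at this
      apply mul_left_cancel₀ (pow_ne_zero 2 hgz)
      push_cast at this ⊢
      linear_combination this
    · refine Nat.mul_le_mul_left _ ?_
      rw [sq]
      exact (Finset.card_le_card (Nat.divisors_subset_of_dvd (Nat.mul_pos hn hn).ne'
        (mul_dvd_mul hmn hmn))).trans hsq
  · calc _ ≤ 25 * n.divisors.card ^ 2 * n.divisors.card :=
          Nat.mul_le_mul_left _ (Finset.card_le_card himg)
      _ = _ := by ring

theorem add_one_le_rpow_mul {L : ℝ} (hL : 0 < L) {p : ℕ} (hp : 2 ≤ p) (a : ℕ) :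
    ((a + 1 : ℕ) : ℝ) ≤ ((p : ℝ) ^ a) ^ (2 / L) *
      (if (p : ℝ) ≤ Real.exp (L / 2) then 1 + L else 1) := by
  have hp' : (2 : ℝ) ≤ p := by exact_mod_cast hp
  have hp0 : (0 : ℝ) < p := by linarith
  have hpow : ((p : ℝ) ^ a) ^ (2 / L) = Real.exp (a * (2 / L) * Real.log p) := by
    rw [Real.rpow_def_of_pos (pow_pos hp0 a), Real.log_pow]
    ring_nf
  have ha : (0 : ℝ) ≤ a := Nat.cast_nonneg a
  rw [hpow]
  push_cast
  split_ifs with h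
  · have hlog : (1 : ℝ) / 2 ≤ Real.log p :=
      le_trans (by linarith [Real.log_two_gt_d9]) (Real.log_le_log (by norm_num) hp')
    have h1 : 1 + a / L ≤ Real.exp (a * (2 / L) * Real.log p) := by
      have : a / L ≤ a * (2 / L) * Real.log p := by
        calc a / L = a * (2 / L) * (1 / 2) := by field_simp
          _ ≤ _ := by gcongr
      linarith [Real.add_one_le_exp (a * (2 / L) * Real.log p)]
    calc (a : ℝ) + 1 ≤ (1 + a / L) * (1 + L) := by
          have : (1 + a / L) * (1 + L) = 1 + a + L + a / L := by field_simp; ring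
          have : 0 ≤ a / L := by positivity
          linarith
      _ ≤ _ := by gcongr
  · have hlog : L / 2 ≤ Real.log p := by
      rw [Real.le_log_iff_exp_le hp0]
      exact (not_le.1 h).le
    have : (a : ℝ) ≤ a * (2 / L) * Real.log p := by
      calc (a : ℝ) = a * (2 / L) * (L / 2) := by field_simp
        _ ≤ _ := by gcongr
    linarith [Real.add_one_le_exp (a * (2 / L) * Real.log p)]

theorem card_divisors_le_rpow {n : ℕ} (hn : 3 ≤ n) :
    (n.divisors.card : ℝ) ≤ (n : ℝ) ^ (10 / Real.log (Real.log n)) := by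
  have hn' : (3 : ℝ) ≤ n := by exact_mod_cast hn
  have hn0 : (0 : ℝ) < n := by linarith
  have hlog : 1 < Real.log n := by
    rw [Real.lt_log_iff_exp_lt hn0]
    linarith [Real.exp_one_lt_d9]
  set L := Real.log (Real.log n) with hLdef
  have hL : 0 < L := Real.log_pos hlog
  have hexpL : Real.exp L = Real.log n := Real.exp_log (by linarith)
  have hcount : ((n.primeFactors.filter fun p : ℕ => (p : ℝ) ≤ Real.exp (L / 2)).card : ℝ)
      ≤ Real.exp (L / 2) := by
    have : (n.primeFactors.filter fun p : ℕ => (p : ℝ) ≤ Real.exp (L / 2)) ⊆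
        Finset.Icc 1 ⌊Real.exp (L / 2)⌋₊ := by
      intro p hp
      rw [Finset.mem_filter] at hp
      exact Finset.mem_Icc.2 ⟨(Nat.prime_of_mem_primeFactors hp.1).one_le, Nat.le_floor hp.2⟩
    have := Finset.card_le_card this
    rw [Nat.card_Icc, Nat.add_sub_cancel] at this
    exact le_trans (by exact_mod_cast this) (Nat.floor_le (Real.exp_pos _).le)
  have hprod : ((n.divisors.card : ℕ) : ℝ) ≤ (n : ℝ) ^ (2 / L) *
      (1 + L) ^ (n.primeFactors.filter fun p : ℕ => (p : ℝ) ≤ Real.exp (L / 2)).card := by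
    rw [Nat.card_divisors (by omega), Nat.cast_prod]
    refine (Finset.prod_le_prod (fun _ _ => Nat.cast_nonneg _) fun p hp =>
      add_one_le_rpow_mul hL (Nat.prime_of_mem_primeFactors hp).two_le _).trans_eq ?_
    rw [Finset.prod_mul_distrib, Real.finsetProd_rpow _ _ (fun _ _ => by positivity),
      Finset.prod_ite, Finset.prod_const, Finset.prod_const_one, mul_one]
    congr 2
    have := Nat.prod_factorization_pow_eq_self (n := n) (by omega)
    conv_rhs => rw [← this]
    rw [Finsupp.prod, Nat.support_factorization]
    push_cast
    rfl
  have hsmall : (1 + L) ^ (n.primeFactors.filter fun p : ℕ => (p : ℝ) ≤ Real.exp (L / 2)).card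
      ≤ (n : ℝ) ^ (8 / L) := by
    calc _ ≤ Real.exp L ^ _ := by
          gcongr
          linarith [Real.add_one_le_exp L]
      _ = Real.exp ((n.primeFactors.filter fun p : ℕ => (p : ℝ) ≤ Real.exp (L / 2)).card * L) := by
          rw [← Real.exp_nat_mul]
      _ ≤ Real.exp (Real.log n * (8 / L)) := by
          apply Real.exp_le_exp.2
          have hq := Real.quadratic_le_exp_of_nonneg (x := L / 2) (by positivity)
          have hL2 : L * L ≤ 8 * Real.exp (L / 2) := by nlinarith
          have hee : Real.log n = Real.exp (L / 2) * Real.exp (L / 2) := by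
            rw [← Real.exp_add, ← hexpL]; ring_nf
          calc _ ≤ Real.exp (L / 2) * L := by gcongr
            _ = Real.exp (L / 2) * (L * L) / L := by field_simp
            _ ≤ Real.exp (L / 2) * (8 * Real.exp (L / 2)) / L := by gcongr
            _ = _ := by rw [hee]; ring
      _ = _ := by rw [Real.rpow_def_of_pos hn0]
  calc (n.divisors.card : ℝ) ≤ _ := hprod
    _ ≤ (n : ℝ) ^ (2 / L) * (n : ℝ) ^ (8 / L) := by gcongr
    _ = _ := by rw [← Real.rpow_add hn0]; ring_nf

theorem exists_int_eq_of_sq_of_mul_sub_mul_sq {d f e n A B : ℤ} {u v : ℝ} (hf : f ≠ 0)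
    (he : e ≠ 0) (hn : n ≠ 0) (hu : u ^ 2 = A) (hv : v ^ 2 = B)
    (h : (d * v - f * u) ^ 2 = ((n : ℝ) * e) ^ 2) : ∃ z : ℤ, u = z := by
  obtain ⟨k, hk0, hk⟩ : ∃ k : ℤ, k ≠ 0 ∧ d * v - f * u = k := by
    rcases sq_eq_sq_iff_eq_or_eq_neg.1 h with h | h
    · exact ⟨n * e, mul_ne_zero hn he, by rw [h]; push_cast; ring⟩
    · exact ⟨-(n * e), neg_ne_zero.2 (mul_ne_zero hn he), by rw [h]; push_cast; ring⟩
  have hM : 2 * k * f ≠ 0 := mul_ne_zero (mul_ne_zero two_ne_zero hk0) hf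
  have hMu : ((2 * k * f : ℤ) : ℝ) * u = (d ^ 2 * B - k ^ 2 - f ^ 2 * A : ℤ) := by
    push_cast
    rw [← hu, ← hv]
    linear_combination (-(d * v) - f * u - k) * hk
  have hdvd : 2 * k * f ∣ d ^ 2 * B - k ^ 2 - f ^ 2 * A := by
    rw [← Int.pow_dvd_pow_iff (n := 2) (by norm_num)]
    refine ⟨A, ?_⟩
    have : (((d ^ 2 * B - k ^ 2 - f ^ 2 * A) ^ 2 : ℤ) : ℝ) = ((2 * k * f) ^ 2 * A : ℤ) := by
      rw [Int.cast_pow, ← hMu, Int.cast_mul _ A, Int.cast_pow, ← hu]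
      ring
    exact_mod_cast this
  obtain ⟨z, hz⟩ := hdvd
  refine ⟨z, mul_left_cancel₀ (Int.cast_ne_zero.2 hM : ((2 * k * f : ℤ) : ℝ) ≠ 0) ?_⟩
  rw [hMu, hz, Int.cast_mul]

/-- For points `p`, `q` of a circle of radius `n / (2 * s)` centred at the origin, whose central
angle is `2 * α`, this is `n * cos α`. -/
noncomputable def scaledHalfAngleCos (s : ℝ) (p q : EuclideanSpace ℝ (Fin 2)) : ℝ :=
  2 * s * (p 0 * q 1 - p 1 * q 0) / dist p q

theorem dist_sq_eq_fin_two (p q : EuclideanSpace ℝ (Fin 2)) :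
    dist p q ^ 2 = (p 0 - q 0) ^ 2 + (p 1 - q 1) ^ 2 := by
  rw [EuclideanSpace.dist_eq, Real.sq_sqrt (by positivity), Fin.sum_univ_two]
  simp [Real.dist_eq, sq_abs]

section

variable {s n : ℝ} {o p q : EuclideanSpace ℝ (Fin 2)}

theorem scaledHalfAngleCos_mul_dist (hp : o ≠ p) :
    scaledHalfAngleCos s o p * dist o p = 2 * s * (o 0 * p 1 - o 1 * p 0) :=
  div_mul_cancel₀ _ (dist_ne_zero.2 hp)

theorem scaledHalfAngleCos_sq_add (ho : 4 * s ^ 2 * (o 0 ^ 2 + o 1 ^ 2) = n ^ 2)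
    (hp : 4 * s ^ 2 * (p 0 ^ 2 + p 1 ^ 2) = n ^ 2) (hop : o ≠ p) :
    scaledHalfAngleCos s o p ^ 2 + s ^ 2 * dist o p ^ 2 = n ^ 2 := by
  have hd := dist_ne_zero.2 hop
  have h1 := scaledHalfAngleCos_mul_dist (s := s) hop
  have h2 := dist_sq_eq_fin_two o p
  apply mul_right_cancel₀ (pow_ne_zero 2 hd)
  rw [add_mul, ← mul_pow, h1, h2]
  linear_combination
    ((o 0 ^ 2 + o 1 ^ 2) / 4 + 3 * (p 0 ^ 2 + p 1 ^ 2) / 4 - (o 0 * p 0 + o 1 * p 1)) * ho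
    + (3 * (o 0 ^ 2 + o 1 ^ 2) / 4 + (p 0 ^ 2 + p 1 ^ 2) / 4 - (o 0 * p 0 + o 1 * p 1)) * hp

theorem dist_mul_scaledHalfAngleCos_sub_sq (ho : 4 * s ^ 2 * (o 0 ^ 2 + o 1 ^ 2) = n ^ 2)
    (hp : 4 * s ^ 2 * (p 0 ^ 2 + p 1 ^ 2) = n ^ 2) (hq : 4 * s ^ 2 * (q 0 ^ 2 + q 1 ^ 2) = n ^ 2)
    (hop : o ≠ p) (hoq : o ≠ q) :
    (dist o p * scaledHalfAngleCos s o q - dist o q * scaledHalfAngleCos s o p) ^ 2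
      = (n * dist p q) ^ 2 := by
  have h1 := scaledHalfAngleCos_mul_dist (s := s) hop
  have h2 := scaledHalfAngleCos_mul_dist (s := s) hoq
  have h3 := scaledHalfAngleCos_sq_add ho hp hop
  have h4 := scaledHalfAngleCos_sq_add ho hq hoq
  have d1 := dist_sq_eq_fin_two o p
  have d2 := dist_sq_eq_fin_two o q
  have d3 := dist_sq_eq_fin_two p q
  have e1 : (dist o p * scaledHalfAngleCos s o q - dist o q * scaledHalfAngleCos s o p) ^ 2 =
      dist o p ^ 2 * (n ^ 2 - s ^ 2 * dist o q ^ 2) + dist o q ^ 2 * (n ^ 2 - s ^ 2 * dist o p ^ 2)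
      - 2 * (2 * s * (o 0 * p 1 - o 1 * p 0)) * (2 * s * (o 0 * q 1 - o 1 * q 0)) := by
    linear_combination dist o p ^ 2 * h4 + dist o q ^ 2 * h3
      - 2 * (scaledHalfAngleCos s o q * dist o q) * h1
      - 2 * (2 * s * (o 0 * p 1 - o 1 * p 0)) * h2
  rw [e1, mul_pow, d1, d2, d3]
  linear_combination
    (-(o 0 ^ 2 + o 1 ^ 2) / 2 + (p 0 ^ 2 + p 1 ^ 2) / 4 + (q 0 ^ 2 + q 1 ^ 2) / 4
      - 2 * (p 0 * q 0 + p 1 * q 1) + (o 0 * p 0 + o 1 * p 1) + (o 0 * q 0 + o 1 * q 1)) * ho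
    + (-3 * (o 0 ^ 2 + o 1 ^ 2) / 4 - (q 0 ^ 2 + q 1 ^ 2) / 4 + (o 0 * q 0 + o 1 * q 1)) * hp
    + (-3 * (o 0 ^ 2 + o 1 ^ 2) / 4 - (p 0 ^ 2 + p 1 ^ 2) / 4 + (o 0 * p 0 + o 1 * p 1)) * hq

theorem eq_of_scaledHalfAngleCos_eq (hs : s ≠ 0) (hn : n ≠ 0)
    (ho : 4 * s ^ 2 * (o 0 ^ 2 + o 1 ^ 2) = n ^ 2)
    (hp : 4 * s ^ 2 * (p 0 ^ 2 + p 1 ^ 2) = n ^ 2) (hq : 4 * s ^ 2 * (q 0 ^ 2 + q 1 ^ 2) = n ^ 2)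
    (hop : o ≠ p) (hoq : o ≠ q) (hd : dist o p = dist o q)
    (hu : scaledHalfAngleCos s o p = scaledHalfAngleCos s o q) : p = q := by
  have hR : o 0 ^ 2 + o 1 ^ 2 ≠ 0 := fun h => by
    rw [h, mul_zero] at ho
    exact hn (pow_eq_zero_iff two_ne_zero |>.1 ho.symm)
  have hcross : o 0 * p 1 - o 1 * p 0 = o 0 * q 1 - o 1 * q 0 := by
    apply mul_left_cancel₀ (mul_ne_zero two_ne_zero hs)
    rw [← scaledHalfAngleCos_mul_dist hop, ← scaledHalfAngleCos_mul_dist hoq, hu, hd]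
  have hpq : p 0 ^ 2 + p 1 ^ 2 = q 0 ^ 2 + q 1 ^ 2 :=
    mul_left_cancel₀ (mul_ne_zero four_ne_zero (pow_ne_zero 2 hs)) (hp.trans hq.symm)
  have hdot : o 0 * p 0 + o 1 * p 1 = o 0 * q 0 + o 1 * q 1 := by
    have h := congrArg (· ^ 2) hd
    simp only [dist_sq_eq_fin_two] at h
    linear_combination (hpq - h) / 2
  ext i
  fin_cases i
  · apply mul_left_cancel₀ hR
    simp only [Fin.zero_eta]
    linear_combination o 0 * hdot - o 1 * hcross
  · apply mul_left_cancel₀ hR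
    simp only [Fin.mk_one]
    linear_combination o 1 * hdot + o 0 * hcross

end

theorem finite_sq_add_mul_sq_eq_sq {D : ℕ} (hD : 0 < D) (m : ℤ) :
    {v : ℤ × ℤ | v.1 ^ 2 + (D : ℤ) * v.2 ^ 2 = m ^ 2}.Finite := by
  refine ((Finset.Icc (-|m|) |m|) ×ˢ (Finset.Icc (-|m|) |m|)).finite_toSet.subset ?_
  intro v hv
  have hD1 : (1 : ℤ) ≤ D := by exact_mod_cast hD
  have hv : v.1 ^ 2 + (D : ℤ) * v.2 ^ 2 = m ^ 2 := hv
  have h2 : v.2 ^ 2 ≤ D * v.2 ^ 2 := le_mul_of_one_le_left (sq_nonneg _) hD1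
  have h1 := sq_nonneg v.1
  have h0 := sq_nonneg v.2
  simp only [Finset.coe_product, Set.mem_prod, Finset.coe_Icc, Set.mem_Icc, ← abs_le]
  exact ⟨sq_le_sq.1 (by linarith), sq_le_sq.1 (by linarith)⟩

theorem card_le_ncard_of_integer_distances {n D n₁ n₂ : ℕ} (hn : 0 < n) (hD : 0 < D)
    (hnn : n = n₁ * n₂)
    (h₁ : ∀ p : ℕ, (hp : p.Prime) → p ∣ n₁ → @legendreSym p ⟨hp⟩ (-(D : ℤ)) = -1)
    (S : Finset (EuclideanSpace ℝ (Fin 2)))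
    (hS : ∀ p ∈ S, ‖p‖ = (n : ℝ) / (2 * Real.sqrt D))
    (hdist : ∀ p ∈ S, ∀ q ∈ S, ∃ z : ℤ, dist p q = z) :
    S.card ≤ {v : ℤ × ℤ | v.1 ^ 2 + (D : ℤ) * v.2 ^ 2 = (n₂ : ℤ) ^ 2}.ncard := by
  have hfin := finite_sq_add_mul_sq_eq_sq hD n₂
  have hn₂ : (n₂ : ℤ) ≠ 0 := by
    rintro h
    have : n₂ = 0 := by exact_mod_cast h
    simp [this] at hnn
    omega
  have hn₁ : (n₁ : ℤ) ≠ 0 := by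
    rintro h
    have : n₁ = 0 := by exact_mod_cast h
    simp [this] at hnn
    omega
  rcases le_or_gt S.card 2 with hcard | hcard
  · have hsub : ((({((n₂ : ℤ), (0 : ℤ)), (-(n₂ : ℤ), (0 : ℤ))} : Finset (ℤ × ℤ))) : Set (ℤ × ℤ)) ⊆
        {v : ℤ × ℤ | v.1 ^ 2 + (D : ℤ) * v.2 ^ 2 = (n₂ : ℤ) ^ 2} := by
      intro v hv
      simp only [Finset.coe_insert, Finset.coe_singleton, Set.mem_insert_iff,
        Set.mem_singleton_iff] at hv
      rcases hv with rfl | rfl <;> simp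
    refine hcard.trans ((Finset.card_pair (a := ((n₂ : ℤ), (0 : ℤ)))
      (b := (-(n₂ : ℤ), (0 : ℤ))) ?_).symm.le.trans ?_)
    · simp only [ne_eq, Prod.mk.injEq, not_and]
      omega
    · rw [← Set.ncard_coe_finset]
      exact Set.ncard_le_ncard hsub hfin
  obtain ⟨o, ho⟩ : S.Nonempty := Finset.card_pos.1 (by omega)
  set s := Real.sqrt D with hs
  have hs2 : s ^ 2 = D := Real.sq_sqrt (Nat.cast_nonneg _)
  have hs0 : s ≠ 0 := (Real.sqrt_pos.2 (by exact_mod_cast hD)).ne'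
  have hn0 : (n : ℝ) ≠ 0 := by exact_mod_cast hn.ne'
  have hcirc : ∀ p ∈ S, 4 * s ^ 2 * (p 0 ^ 2 + p 1 ^ 2) = (n : ℝ) ^ 2 := by
    intro p hp
    have h := congrArg (· ^ 2) (hS p hp)
    simp only [EuclideanSpace.norm_eq] at h
    rw [Real.sq_sqrt (by positivity), Fin.sum_univ_two, Real.norm_eq_abs, Real.norm_eq_abs,
      sq_abs, sq_abs] at h
    rw [h]
    field_simp
    norm_num
  choose! δ hδ using hdist
  have hδ0 : ∀ p ∈ S, ∀ q ∈ S, p ≠ q → δ p q ≠ 0 := by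
    intro p hp q hq hpq h
    have := hδ p hp q hq
    rw [h, Int.cast_zero] at this
    exact hpq (dist_eq_zero.1 this)
  have hsq : ∀ p ∈ S, o ≠ p → scaledHalfAngleCos s o p ^ 2 =
      ((n : ℤ) ^ 2 - D * δ o p ^ 2 : ℤ) := by
    intro p hp hop
    have := scaledHalfAngleCos_sq_add (hcirc o ho) (hcirc p hp) hop
    rw [hδ o ho p hp, hs2] at this
    push_cast
    linear_combination this
  have hint : ∀ p ∈ S, ∃ z : ℤ, o ≠ p → scaledHalfAngleCos s o p = z := by
    intro p hp
    by_cases hop : o = p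
    · exact ⟨0, fun h => absurd hop h⟩
    obtain ⟨q, hq, hpq, hoq⟩ : ∃ q ∈ S, p ≠ q ∧ o ≠ q := by
      classical
      obtain ⟨q, hq⟩ : ((S.erase o).erase p).Nonempty := by
        rw [← Finset.card_pos, Finset.card_erase_of_mem
          (Finset.mem_erase.2 ⟨Ne.symm hop, hp⟩), Finset.card_erase_of_mem ho]
        omega
      simp only [Finset.mem_erase] at hq
      exact ⟨q, hq.2.2, hq.1.symm, hq.2.1.symm⟩
    have key := dist_mul_scaledHalfAngleCos_sub_sq (hcirc o ho) (hcirc p hp) (hcirc q hq) hop hoq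
    rw [hδ o ho p hp, hδ o ho q hq, hδ p hp q hq] at key
    obtain ⟨z, hz⟩ := exists_int_eq_of_sq_of_mul_sub_mul_sq (n := n) (hδ0 o ho q hq hoq)
      (hδ0 p hp q hq hpq) (by exact_mod_cast hn.ne') (hsq p hp hop) (hsq q hq hoq)
      (by exact_mod_cast key)
    exact ⟨z, fun _ => hz⟩
  choose! u hu using hint
  have hrep : ∀ p ∈ S, ∃ v : ℤ × ℤ, (v.1 ^ 2 + (D : ℤ) * v.2 ^ 2 = (n₂ : ℤ) ^ 2) ∧
      n₁ * v.2 = δ o p ∧ (o ≠ p → n₁ * v.1 = u p) := by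
    intro p hp
    by_cases hop : o = p
    · subst hop
      have := hδ o ho o ho
      rw [dist_self] at this
      refine ⟨(n₂, 0), by simp, ?_, fun h => absurd rfl h⟩
      rw [mul_zero]
      exact_mod_cast this
    have h := hsq p hp hop
    rw [hu p hp hop] at h
    have h' : u p ^ 2 + (D : ℤ) * δ o p ^ 2 = ((n₁ : ℤ) * n₂) ^ 2 := by
      have : u p ^ 2 = (n : ℤ) ^ 2 - D * δ o p ^ 2 := by exact_mod_cast h
      rw [this, hnn]
      push_cast
      ring
    obtain ⟨⟨x, hx⟩, y, hy⟩ := dvd_of_sq_add_mul_sq_eq_of_legendreSym_eq_neg_one hD n₁ h₁ h'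
    refine ⟨(x, y), ?_, hy.symm, fun _ => hx.symm⟩
    rw [hx, hy] at h'
    apply mul_left_cancel₀ (pow_ne_zero 2 hn₁)
    linear_combination h'
  choose! v hv using hrep
  rw [← Set.ncard_coe_finset]
  refine Set.ncard_le_ncard_of_injOn v (fun p hp => (hv p hp).1) ?_ hfin
  intro p hp q hq hpq
  obtain ⟨-, a1, a2⟩ := hv p hp
  obtain ⟨-, b1, b2⟩ := hv q hq
  have hdd : δ o p = δ o q := by rw [← a1, ← b1, hpq]
  have hd : dist o p = dist o q := by rw [hδ o ho p hp, hδ o ho q hq, hdd]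
  by_cases hop : o = p
  · rw [← hop, dist_self] at hd
    rw [← hop]
    exact dist_eq_zero.1 hd.symm
  have hoq : o ≠ q := by
    rw [← dist_ne_zero, ← hd]
    exact dist_ne_zero.2 hop
  refine eq_of_scaledHalfAngleCos_eq hs0 hn0 (hcirc o ho) (hcirc p hp) (hcirc q hq) hop hoq hd ?_
  rw [hu p hp hop, hu q hq hoq, ← a2 hop, ← b2 hoq, hpq]

theorem stmt_15 :
    ∃ C > (0 : ℝ), ∃ c > (0 : ℝ), ∀ n D n₁ n₂ : ℕ, 3 ≤ n → 0 < D →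
      Nat.Coprime n D → Squarefree D → n = n₁ * n₂ →
      (∀ p : ℕ, (hp : p.Prime) → p ∣ n₁ → @legendreSym p ⟨hp⟩ (-(D : ℤ)) = -1) →
      (∀ p : ℕ, (hp : p.Prime) → p ∣ n₂ → @legendreSym p ⟨hp⟩ (-(D : ℤ)) = 1) →
      ∀ S : Finset (EuclideanSpace ℝ (Fin 2)),
        (∀ p ∈ S, ‖p‖ = (n : ℝ) / (2 * Real.sqrt D)) →
        (∀ p ∈ S, ∀ q ∈ S, ∃ z : ℤ, dist p q = z) →
        S.card ≤ {v : ℤ × ℤ | v.1 ^ 2 + (D : ℤ) * v.2 ^ 2 = (n₂ : ℤ) ^ 2}.ncard ∧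
        (S.card : ℝ) ≤ C * (n : ℝ) ^ (c / Real.log (Real.log n)) := by 
  refine ⟨25, by norm_num, 30, by norm_num, ?_⟩
  intro n D n₁ n₂ hn hD hnD _ hnn h₁ _ S hS hdist
  have hcard := card_le_ncard_of_integer_distances (by omega) hD hnn h₁ S hS hdist
  refine ⟨hcard, ?_⟩
  have hn₂ : n₂ ∣ n := ⟨n₁, by rw [hnn, mul_comm]⟩
  have hn0 : (0 : ℝ) ≤ n := Nat.cast_nonneg n
  have hfin := finite_sq_add_mul_sq_eq_sq hD n₂
  have hrep := card_sq_add_mul_sq_eq_sq_le hD (Nat.pos_of_dvd_of_pos hn₂ (by omega))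
    (hnD.coprime_dvd_left hn₂) hfin.toFinset fun v hv => by simpa using hv
  rw [← Set.ncard_eq_toFinset_card _ hfin] at hrep
  have hdiv : n₂.divisors.card ≤ n.divisors.card :=
    Finset.card_le_card (Nat.divisors_subset_of_dvd (by omega) hn₂)
  calc (S.card : ℝ) ≤ 25 * (n.divisors.card : ℝ) ^ 3 := by
        exact_mod_cast hcard.trans (hrep.trans (by gcongr))
    _ ≤ 25 * ((n : ℝ) ^ (10 / Real.log (Real.log n))) ^ 3 := by
        gcongr
        exact card_divisors_le_rpow hn
    _ = 25 * (n : ℝ) ^ (30 / Real.log (Real.log n)) := by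
        rw [← Real.rpow_mul_natCast hn0]
        congr 2
        push_cast
        ring
end

section
/- Let C ⊂ ℂ² be an irreducible affine curve of degree d, m a squarefree positive integer, and suppose C contains at least d² + 1 points of the form (x, y√m) with x, y ∈ ℚ. Then C' = {(x,y) ∈ ℂ² : (x, y√m) ∈ C} is an irreducible affine curve of degree d that is the zero set of a nonzero polynomial with rational coefficients. -/
open MvPolynomial in
theorem finrank_restrictTotalDegree_fin_two (K : Type*) [Field K] (k : ℕ) :
    2 * Module.finrank K (restrictTotalDegree (Fin 2) K k) = (k + 1) * (k + 2) := by
  let e : {n : Fin 2 →₀ ℕ | (n.sum fun _ e => e) ≤ k} ≃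
      {p // p ∈ (Finset.range (k + 1)).biUnion fun i => Finset.HasAntidiagonal.antidiagonal i} :=
    (finTwoArrowEquiv' ℕ).subtypeEquiv fun n => by
      rw [Set.mem_ofPred_eq, Finsupp.sum_fintype _ _ (fun _ => rfl)]
      simp [finTwoArrowEquiv', Fin.sum_univ_two]
  have h : Module.finrank K (restrictTotalDegree (Fin 2) K k) =
      ∑ i ∈ Finset.range (k + 1), (i + 1) := by
    rw [restrictTotalDegree, Module.finrank_eq_nat_card_basis (basisRestrictSupport K _),
      Nat.card_congr e, Nat.card_eq_fintype_card, Fintype.card_coe, Finset.card_biUnion]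
    · simp
    · intro i _ j _ hij
      rw [Function.onFun, Finset.disjoint_left]
      intro p hp hq
      exact hij (by rw [← Finset.HasAntidiagonal.mem_antidiagonal.1 hp,
        ← Finset.HasAntidiagonal.mem_antidiagonal.1 hq])
  rw [h]
  clear h e
  induction k with
  | zero => simp
  | succ k ih => rw [Finset.sum_range_succ, mul_add, ih]; ring

open MvPolynomial in
/-- Interpolation: values at the points of a finite set can be prescribed by polynomials of
degree less than the number of points. -/
theorem exists_totalDegree_le_eval_eq {K σ : Type*} [Field K] (s : Finset (σ → K)) {k : ℕ}
    (hk : s.card ≤ k) (v : s → K) :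
    ∃ p : MvPolynomial σ K, p.totalDegree ≤ k ∧ ∀ x : s, eval x.1 p = v x := by
  classical
  have sep : ∀ x y : σ → K, ∃ l : MvPolynomial σ K, l.totalDegree ≤ 1 ∧
      eval y l = 0 ∧ (x ≠ y → eval x l ≠ 0) := by
    intro x y
    by_cases h : x = y
    · exact ⟨0, by simp, by simp, fun hn => absurd h hn⟩
    · obtain ⟨i, hi⟩ := Function.ne_iff.1 h
      refine ⟨X i - C (y i), (totalDegree_sub_C_le _ _).trans (totalDegree_X _).le, by simp, ?_⟩
      simpa [sub_eq_zero] using fun _ => hi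
  choose l hl hly hlx using sep
  have ev : ∀ x ∈ s, ∀ y ∈ s, eval y (∏ z ∈ s.erase x, l x z) =
      if y = x then ∏ z ∈ s.erase x, eval x (l x z) else 0 := by
    intro x _ y hy
    rw [map_prod]
    split_ifs with h
    · rw [h]
    · exact Finset.prod_eq_zero (Finset.mem_erase.2 ⟨h, hy⟩) (hly x y)
  refine ⟨∑ x : s, C (v x / ∏ z ∈ s.erase x.1, eval x.1 (l x.1 z)) * ∏ z ∈ s.erase x.1, l x.1 z,
    totalDegree_finsetSum_le fun x _ => ?_, fun y => ?_⟩
  · refine (totalDegree_mul _ _).trans ?_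
    rw [totalDegree_C, zero_add]
    refine (totalDegree_finsetProd _ _).trans ((Finset.sum_le_card_nsmul _ _ 1 ?_).trans ?_)
    · exact fun z _ => hl _ z
    · rw [smul_eq_mul, mul_one]
      exact (Finset.card_le_card (Finset.erase_subset _ _)).trans hk
  · rw [map_sum, Finset.sum_eq_single y]
    · rw [map_mul, ev _ y.2 _ y.2, if_pos rfl, eval_C, div_mul_cancel₀]
      exact Finset.prod_ne_zero_iff.2 fun z hz => hlx _ _ (Finset.ne_of_mem_erase hz).symm
    · intro x _ hx
      rw [map_mul, ev _ x.2 _ y.2, if_neg (fun h => hx (Subtype.ext h.symm)), mul_zero]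
    · simp

open MvPolynomial in
/-- A weak form of Bézout's theorem. -/
theorem card_le_mul_totalDegree_of_not_dvd {K : Type*} [Field K] {f h : MvPolynomial (Fin 2) K}
    (hf : Irreducible f) (hfh : ¬ f ∣ h) (s : Finset (Fin 2 → K))
    (hsf : ∀ x ∈ s, eval x f = 0) (hsh : ∀ x ∈ s, eval x h = 0) :
    s.card ≤ f.totalDegree * h.totalDegree := by
  have hf0 : f ≠ 0 := hf.ne_zero
  have hh0 : h ≠ 0 := fun h0 => hfh (h0 ▸ dvd_zero f)
  set d := f.totalDegree with hd
  set e := h.totalDegree with he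
  set N := s.card with hN
  let V := restrictTotalDegree (Fin 2) K
  let mulL (p : MvPolynomial (Fin 2) K) (k : ℕ) : Submodule K (MvPolynomial (Fin 2) K) :=
    (V k).map (LinearMap.mulLeft K p)
  have finrank_mulL : ∀ p ≠ 0, ∀ k, Module.finrank K (mulL p k) = Module.finrank K (V k) :=
    fun p hp k => (Submodule.equivMapOfInjective _ (mul_right_injective₀ hp) (V k)).finrank_eq.symm
  let ev : V (d + e + N) →ₗ[K] (s → K) :=
    LinearMap.pi fun x => (aeval x.1).toLinearMap ∘ₗ (V (d + e + N)).subtype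
  have ev_apply : ∀ p x, ev p x = eval x.1 p.1 := fun p x => by
    change aeval x.1 p.1 = _
    rw [aeval_eq_eval]
  have hev : Function.Surjective ev := by
    intro v
    obtain ⟨p, hp, hpv⟩ := exists_totalDegree_le_eval_eq s (k := d + e + N) (by omega) v
    refine ⟨⟨p, (mem_restrictTotalDegree _ _ _).2 hp⟩, funext fun x => ?_⟩
    rw [ev_apply, hpv]
  have hker : N + Module.finrank K (LinearMap.ker ev) = Module.finrank K (V (d + e + N)) := by
    rw [← LinearMap.finrank_range_add_finrank_ker ev, LinearMap.range_eq_top.2 hev, finrank_top]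
    simp [hN]
  have mulL_le : ∀ p : MvPolynomial (Fin 2) K, ∀ k, p.totalDegree + k = d + e + N →
      (∀ x ∈ s, eval x p = 0) → mulL p k ≤ (LinearMap.ker ev).map (V (d + e + N)).subtype := by
    rintro p k hk hp _ ⟨a, ha, rfl⟩
    have ha' := (mem_restrictTotalDegree _ _ _).1 ha
    refine ⟨⟨p * a, (mem_restrictTotalDegree _ _ _).2 ?_⟩, ?_, rfl⟩
    · exact (totalDegree_mul _ _).trans (by omega)
    · refine LinearMap.mem_ker.2 (funext fun x => ?_)
      rw [ev_apply, map_mul, hp _ x.2, zero_mul, Pi.zero_apply]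
  have hsup := Submodule.finrank_mono (sup_le (mulL_le f (e + N) (by omega) hsf)
    (mulL_le h (d + N) (by omega) hsh))
  rw [Submodule.finrank_map_subtype_eq] at hsup
  have hinf : mulL f (e + N) ⊓ mulL h (d + N) ≤ mulL (f * h) N := by
    rintro _ ⟨⟨a, ha, rfl⟩, b, hb, hab⟩
    have hab : h * b = f * a := hab
    obtain ⟨c, rfl⟩ := (hf.prime.dvd_or_dvd (Dvd.intro a hab.symm)).resolve_left hfh
    refine ⟨c, (mem_restrictTotalDegree _ _ _).2 ?_, ?_⟩
    · have hb := (mem_restrictTotalDegree _ _ _).1 hb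
      rcases eq_or_ne c 0 with rfl | hc
      · simp
      · rw [totalDegree_mul_of_isDomain hf0 hc] at hb
        omega
    · change f * h * c = f * a
      rw [← hab]; ring
  have hinf := Submodule.finrank_mono hinf
  have hadd := Submodule.finrank_sup_add_finrank_inf_eq (mulL f (e + N)) (mulL h (d + N))
  rw [finrank_mulL _ hf0, finrank_mulL _ hh0] at hadd
  rw [finrank_mulL _ (mul_ne_zero hf0 hh0)] at hinf
  have h1 := finrank_restrictTotalDegree_fin_two K (d + e + N)
  have h2 := finrank_restrictTotalDegree_fin_two K (e + N)
  have h3 := finrank_restrictTotalDegree_fin_two K (d + N)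
  have h4 := finrank_restrictTotalDegree_fin_two K N
  simp only [V] at *
  nlinarith

open MvPolynomial in
/-- Rescaling the variables by nonzero constants, as an automorphism. -/
noncomputable def MvPolynomial.scaleEquiv {K σ : Type*} [Field K] (c : σ → Kˣ) :
    MvPolynomial σ K ≃ₐ[K] MvPolynomial σ K :=
  AlgEquiv.ofAlgHom (aeval fun i => C (c i : K) * X i) (aeval fun i => C (↑(c i)⁻¹ : K) * X i)
    (by ext i : 1; simp [← mul_assoc, ← C_mul, algebraMap_eq])
    (by ext i : 1; simp [← mul_assoc, ← C_mul, algebraMap_eq])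

open MvPolynomial in
theorem MvPolynomial.eval_scaleEquiv {K σ : Type*} [Field K] (c : σ → Kˣ) (x : σ → K)
    (p : MvPolynomial σ K) : eval x (scaleEquiv c p) = eval (fun i => c i * x i) p := by
  change eval x (aeval _ p) = _
  rw [aeval_def, eval₂_eq, map_sum, eval_eq]
  simp [algebraMap_eq]

open MvPolynomial in
theorem MvPolynomial.totalDegree_scaleEquiv_le {K σ : Type*} [Field K] (c : σ → Kˣ)
    (p : MvPolynomial σ K) : (scaleEquiv c p).totalDegree ≤ p.totalDegree := by
  change (aeval (fun i => C (c i : K) * X i) p).totalDegree ≤ _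
  rw [aeval_def, eval₂_eq]
  refine totalDegree_finsetSum_le fun n hn => (totalDegree_mul _ _).trans ?_
  rw [algebraMap_eq, totalDegree_C, zero_add]
  refine (totalDegree_finsetProd _ _).trans (le_trans ?_ (le_totalDegree hn))
  refine Finset.sum_le_sum fun i _ => (totalDegree_pow _ _).trans ?_
  refine (Nat.mul_le_mul_left _ (totalDegree_mul _ _)).trans ?_
  simp

open MvPolynomial in
theorem MvPolynomial.totalDegree_scaleEquiv {K σ : Type*} [Field K] (c : σ → Kˣ)
    (p : MvPolynomial σ K) : (scaleEquiv c p).totalDegree = p.totalDegree := by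
  refine (totalDegree_scaleEquiv_le c p).antisymm ?_
  have h := totalDegree_scaleEquiv_le (fun i => (c i)⁻¹) (scaleEquiv c p)
  have : scaleEquiv (fun i => (c i)⁻¹) (scaleEquiv c p) = p := (scaleEquiv c).symm_apply_apply p
  rwa [this] at h

open MvPolynomial in
/-- If a polynomial over an extension field vanishes at a set of points with coordinates in the
base field, then so does a nonzero polynomial over the base field of no larger degree. -/
theorem exists_totalDegree_le_forall_eval_eq_zero {k K σ : Type*} [Field k] [Field K]
    [Algebra k K] {g : MvPolynomial σ K} (hg : g ≠ 0) :
    ∃ q : MvPolynomial σ k, q ≠ 0 ∧ q.totalDegree ≤ g.totalDegree ∧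
      ∀ x : σ → k, eval (fun i => algebraMap k K (x i)) g = 0 → eval x q = 0 := by
  classical
  obtain ⟨n, hn⟩ := ne_zero_iff.1 hg
  obtain ⟨φ, hφ⟩ := Module.Projective.exists_dual_ne_zero k hn
  refine ⟨∑ n ∈ g.support, monomial n (φ (coeff n g)), ?_, ?_, ?_⟩
  · refine ne_zero_iff.2 ⟨n, ?_⟩
    simpa [coeff_sum, coeff_monomial, hn] using hφ
  · exact totalDegree_finsetSum_le fun n hn =>
      (totalDegree_monomial_le _ _).trans (le_totalDegree hn)
  · intro x hx
    have h := congrArg φ hx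
    rw [eval_eq, map_sum, map_zero] at h
    rw [map_sum, ← h]
    refine Finset.sum_congr rfl fun n _ => ?_
    rw [eval_monomial, Finsupp.prod, mul_comm]
    simp_rw [← map_pow]
    rw [← map_prod, mul_comm (coeff n g), ← Algebra.smul_def, map_smul, smul_eq_mul]


theorem stmt_17 (d : ℕ) (f : MvPolynomial (Fin 2) ℂ) (hf : Irreducible f)
    (hdeg : f.totalDegree = d) (m : ℕ) (hm : Squarefree m) (hmpos : 0 < m)
    (P : Finset (ℚ × ℚ)) (hcard : d ^ 2 + 1 ≤ P.card)
    (hP : ∀ q ∈ P, MvPolynomial.eval ![(q.1 : ℂ), (q.2 : ℂ) * (Real.sqrt m : ℂ)] f = 0) :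
    ∃ g : MvPolynomial (Fin 2) ℚ, g ≠ 0 ∧
      Irreducible (MvPolynomial.map (algebraMap ℚ ℂ) g) ∧
      (MvPolynomial.map (algebraMap ℚ ℂ) g).totalDegree = d ∧
      {p : ℂ × ℂ | MvPolynomial.eval ![p.1, p.2] (MvPolynomial.map (algebraMap ℚ ℂ) g) = 0}
        = {p : ℂ × ℂ | MvPolynomial.eval ![p.1, p.2 * (Real.sqrt m : ℂ)] f = 0} := by
  have hs : (Real.sqrt m : ℂ) ≠ 0 := by
    exact_mod_cast (Real.sqrt_pos.2 (Nat.cast_pos.2 hmpos)).ne'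
  let σ := MvPolynomial.scaleEquiv ![1, Units.mk0 _ hs]
  have eval_σ : ∀ x y : ℂ, MvPolynomial.eval ![x, y] (σ f) =
      MvPolynomial.eval ![x, y * (Real.sqrt m : ℂ)] f := by
    intro x y
    rw [MvPolynomial.eval_scaleEquiv]
    congr 2
    ext i
    fin_cases i <;> simp [mul_comm]
  have hirr : Irreducible (σ f) := (MulEquiv.irreducible_iff σ).2 hf
  have hσdeg : (σ f).totalDegree = d := (MvPolynomial.totalDegree_scaleEquiv _ f).trans hdeg
  obtain ⟨q, hq0, hqdeg, hq⟩ :=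
    exists_totalDegree_le_forall_eval_eq_zero (k := ℚ) hirr.ne_zero
  have hinj := MvPolynomial.map_injective (σ := Fin 2) _ (algebraMap ℚ ℂ).injective
  have hQ0 : MvPolynomial.map (algebraMap ℚ ℂ) q ≠ 0 := (map_ne_zero_iff _ hinj).2 hq0
  have hQdeg : (MvPolynomial.map (algebraMap ℚ ℂ) q).totalDegree ≤ d := by
    rw [← hσdeg]
    exact (Finset.sup_mono (MvPolynomial.support_map_subset _ _)).trans hqdeg
  let ι : ℚ × ℚ ↪ (Fin 2 → ℂ) := ⟨fun p => ![(p.1 : ℂ), (p.2 : ℂ)], fun p p' h =>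
    Prod.ext (by simpa using congrFun h 0) (by simpa using congrFun h 1)⟩
  have hvan : ∀ p ∈ P, MvPolynomial.eval (ι p) (σ f) = 0 := fun p hp =>
    (eval_σ p.1 p.2).trans (hP p hp)
  have hι : ∀ p, ι p = fun i => algebraMap ℚ ℂ (![p.1, p.2] i) := by
    intro p
    ext i
    fin_cases i
    · exact (eq_ratCast _ _).symm
    · exact (eq_ratCast _ _).symm
  have hdvd : σ f ∣ MvPolynomial.map (algebraMap ℚ ℂ) q := by
    by_contra hnd
    have h := card_le_mul_totalDegree_of_not_dvd hirr hnd (P.map ι)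
      (Finset.forall_mem_map.2 hvan) (Finset.forall_mem_map.2 fun p hp => by
        have h0 := hq ![p.1, p.2] (by rw [← hι]; exact hvan p hp)
        have := MvPolynomial.eval₂_comp_left (algebraMap ℚ ℂ) (RingHom.id ℚ) ![p.1, p.2] q
        rw [hι, MvPolynomial.eval_map]
        exact this.symm.trans ((congrArg _ h0).trans (map_zero _)))
    rw [Finset.card_map, hσdeg] at h
    nlinarith [Nat.mul_le_mul_left d hQdeg]
  obtain ⟨c, hc⟩ := hdvd
  have hc0 : c ≠ 0 := by
    rintro rfl
    exact hQ0 (by rw [hc, mul_zero])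
  have hdegs := MvPolynomial.totalDegree_mul_of_isDomain hirr.ne_zero hc0
  rw [← hc, hσdeg] at hdegs
  obtain ⟨a, rfl⟩ : ∃ a, c = MvPolynomial.C a :=
    ⟨_, MvPolynomial.totalDegree_eq_zero_iff_eq_C.1 (by omega)⟩
  have ha : a ≠ 0 := by rintro rfl; exact hc0 (map_zero _)
  refine ⟨q, hq0, ?_, by rw [hdegs, MvPolynomial.totalDegree_C, add_zero], ?_⟩
  · rw [hc]
    exact (irreducible_mul_isUnit (ha.isUnit.map MvPolynomial.C)).2 hirr
  · ext p
    simp only [Set.mem_ofPred_eq, hc, map_mul, MvPolynomial.eval_C, mul_eq_zero, ha, or_false,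
      eval_σ]
end
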